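/- For every odd integer d ≥ 3, every δ ∈ [0,1], and all r, w, v ∈ (ZMod d)², the phase-space coefficient of C satisfies Tr[(A^r ⊗ A^w ⊗ A^v)·C] = 2α·(1 − Re(Tr[A^w A^v A^r])), and consequently Tr[(A^r ⊗ A^w ⊗ A^v)·C] ≤ 0. -/

import Mathlib

open Matrix

noncomputable section

/-- ω = exp(2πi/d). -/
def wUnit (d : ℕ) : ℂ := Complex.exp (2 * (Real.pi : ℂ) * Complex.I / d)

/-- τ = exp((d+1)πi/d). -/
def tUnit (d : ℕ) : ℂ := Complex.exp (((d : ℂ) + 1) * (Real.pi : ℂ) * Complex.I / d)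

/-- The shift operator, X|k⟩ = |k+1⟩. -/
def shiftX (d : ℕ) : Matrix (ZMod d) (ZMod d) ℂ :=
  Matrix.of fun i j => if i = j + 1 then 1 else 0

/-- The clock operator, Z|k⟩ = ω^k |k⟩. -/
def clockZ (d : ℕ) : Matrix (ZMod d) (ZMod d) ℂ :=
  Matrix.of fun i j => if i = j then wUnit d ^ j.val else 0

/-- The Heisenberg-Weyl operator T_u = τ^{-a₁a₂} Z^{a₁} X^{a₂}. -/
def HW (d : ℕ) [NeZero d] (u : ZMod d × ZMod d) : Matrix (ZMod d) (ZMod d) ℂ :=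
  tUnit d ^ (-(u.1 * u.2)).val • (clockZ d ^ (u.1).val * shiftX d ^ (u.2).val)

/-- The phase space point operator at the origin, A^0 = (1/d) Σ_u T_u. -/
def A0 (d : ℕ) [NeZero d] : Matrix (ZMod d) (ZMod d) ℂ :=
  (1 / (d : ℂ)) • ∑ u : ZMod d × ZMod d, HW d u

/-- The phase space point operator A^u = T_u A^0 (T_u)†. -/
def Apt (d : ℕ) [NeZero d] (u : ZMod d × ZMod d) : Matrix (ZMod d) (ZMod d) ℂ :=
  HW d u * A0 d * (HW d u)ᴴ

/-- Index type for (ℂ^d)^{⊗3} with factors indexed by ZMod d. -/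
abbrev Idx (d : ℕ) := Fin 3 → ZMod d

/-- The operator on (ℂ^d)^{⊗3} permuting the tensor factors according to c ∈ S₃. -/
def Perm3 (d : ℕ) (c : Equiv.Perm (Fin 3)) : Matrix (Idx d) (Idx d) ℂ :=
  Matrix.of fun i j => if ∀ k, i k = j (c⁻¹ k) then 1 else 0

/-- The tensor product A ⊗ B ⊗ C as an operator on (ℂ^d)^{⊗3}. -/
def kron3 (d : ℕ) (A B C : Matrix (ZMod d) (ZMod d) ℂ) : Matrix (Idx d) (Idx d) ℂ :=
  Matrix.of fun i j => A (i 0) (j 0) * B (i 1) (j 1) * C (i 2) (j 2)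

section CharacterForm

lemma clockZ_eq_diagonal (d : ℕ) : clockZ d = Matrix.diagonal fun j => wUnit d ^ j.val := by
  ext i j
  by_cases hij : i = j <;> simp [clockZ, hij]

variable {d : ℕ} [NeZero d]

lemma wUnit_pow_val (x : ZMod d) : wUnit d ^ x.val = ZMod.stdAddChar x := by
  rw [wUnit, ← Complex.exp_nat_mul, ZMod.stdAddChar_apply, ZMod.toCircle_apply]
  congr 1
  ring

lemma stdAddChar_pow_val (x y : ZMod d) :
    (ZMod.stdAddChar x : ℂ) ^ y.val = ZMod.stdAddChar (y * x) := by
  rw [← AddChar.map_nsmul_eq_pow, nsmul_eq_mul, ZMod.natCast_zmod_val]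

/-- For odd `d` the phase τ is the standard character at the inverse of `2`. -/
lemma exists_half_tUnit (hodd : Odd d) :
    ∃ h : ZMod d, 2 * h = 1 ∧ tUnit d = ZMod.stdAddChar h := by
  obtain ⟨m, hm⟩ := hodd
  refine ⟨((m + 1 : ℕ) : ZMod d), ?_, ?_⟩
  · have h0 : ((2 * m + 1 : ℕ) : ZMod d) = 0 := by rw [← hm]; exact ZMod.natCast_self d
    push_cast at h0 ⊢
    linear_combination h0
  · have hcast := ZMod.stdAddChar_coe (N := d) ((m + 1 : ℕ) : ℤ)
    rw [Int.cast_natCast] at hcast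
    rw [hcast, tUnit]
    congr 2
    rw [hm]
    push_cast
    ring

lemma isUnit_two_zmod (hodd : Odd d) : IsUnit (2 : ZMod d) := by
  obtain ⟨h, hh, -⟩ := exists_half_tUnit hodd
  exact IsUnit.of_mul_eq_one h hh

lemma shiftX_pow_apply (n : ℕ) (i j : ZMod d) :
    (shiftX d ^ n) i j = if i = j + n then 1 else 0 := by
  induction n generalizing i j with
  | zero => simp [Matrix.one_apply]
  | succ n ih =>
    rw [pow_succ, Matrix.mul_apply]
    simp only [ih]
    simp [shiftX, add_assoc, add_comm (1 : ZMod d)]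

lemma HW_apply {h : ZMod d} (hτ : tUnit d = ZMod.stdAddChar h) (u : ZMod d × ZMod d)
    (i j : ZMod d) :
    HW d u i j = if j = i - u.2 then ZMod.stdAddChar (u.1 * i - h * (u.1 * u.2)) else 0 := by
  have hij : i = j + u.2 ↔ j = i - u.2 := by rw [eq_sub_iff_add_eq, eq_comm]
  rw [HW, clockZ_eq_diagonal, Matrix.diagonal_pow, Matrix.smul_apply, Matrix.diagonal_mul,
    shiftX_pow_apply, hτ]
  simp only [Pi.pow_apply, wUnit_pow_val, stdAddChar_pow_val, ZMod.natCast_zmod_val, hij,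
    smul_eq_mul, mul_ite, mul_one, mul_zero, ← AddChar.map_add_eq_mul]
  congr 2
  ring

lemma A0_apply (hodd : Odd d) (i j : ZMod d) : A0 d i j = if j = -i then 1 else 0 := by
  obtain ⟨h, hh, hτ⟩ := exists_half_tUnit hodd
  have hsum : ∑ a : ZMod d, (ZMod.stdAddChar (a * (h * (i + j))) : ℂ) =
      if h * (i + j) = 0 then (d : ℂ) else 0 := by
    rw [AddChar.sum_mulShift _ (ZMod.isPrimitive_stdAddChar d), ZMod.card]
    split_ifs <;> simp
  have hzero : h * (i + j) = 0 ↔ j = -i := by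
    constructor
    · intro H
      linear_combination 2 * H - (i + j) * hh
    · rintro rfl
      ring
  rw [A0, Matrix.smul_apply, Matrix.sum_apply, Fintype.sum_prod_type]
  simp only [HW_apply hτ]
  have hinner (a : ZMod d) : (∑ b : ZMod d, if j = i - b then
      (ZMod.stdAddChar (a * i - h * (a * b)) : ℂ) else 0) =
      ZMod.stdAddChar (a * (h * (i + j))) := by
    rw [Finset.sum_eq_single (i - j)]
    · rw [if_pos (by ring)]
      congr 1
      linear_combination -a * i * hh
    · intro b _ hb
      rw [if_neg]
      rintro rfl
      exact hb (by ring)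
    · simp
  simp only [hinner, hsum, hzero, smul_eq_mul]
  split_ifs <;> simp [NeZero.ne d]

lemma Apt_apply (hodd : Odd d) (u : ZMod d × ZMod d) (i j : ZMod d) :
    Apt d u i j = if j = 2 * u.2 - i then ZMod.stdAddChar (u.1 * (i - j)) else 0 := by
  obtain ⟨h, -, hτ⟩ := exists_half_tUnit hodd
  have hmid (k : ZMod d) : (HW d u * A0 d) i k = if k = u.2 - i then
      ZMod.stdAddChar (u.1 * i - h * (u.1 * u.2)) else 0 := by
    simp only [Matrix.mul_apply, HW_apply hτ, A0_apply hodd, ite_mul, zero_mul,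
      Finset.sum_ite_eq', Finset.mem_univ, if_true, neg_sub]
    simp only [mul_ite, mul_one, mul_zero]
  rw [Apt, Matrix.mul_apply]
  simp only [hmid, Matrix.conjTranspose_apply, HW_apply hτ, ite_mul, zero_mul,
    Finset.sum_ite_eq', Finset.mem_univ, if_true]
  have hij : u.2 - i = j - u.2 ↔ j = 2 * u.2 - i := by
    constructor <;> intro H <;> linear_combination -H
  simp only [hij]
  split_ifs
  · rw [← starRingEnd_apply, ← AddChar.map_neg_eq_conj, ← AddChar.map_add_eq_mul]
    congr 1
    ring
  · simp

lemma Apt_isHermitian (hodd : Odd d) (u : ZMod d × ZMod d) : (Apt d u).IsHermitian := by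
  ext i j
  have hij : i = 2 * u.2 - j ↔ j = 2 * u.2 - i := by
    constructor <;> intro H <;> linear_combination H
  rw [Matrix.conjTranspose_apply, Apt_apply hodd, Apt_apply hodd]
  simp only [hij]
  split_ifs
  · rw [← starRingEnd_apply, ← AddChar.map_neg_eq_conj]
    congr 1
    ring
  · simp

lemma Apt_trace (hodd : Odd d) (u : ZMod d × ZMod d) : (Apt d u).trace = 1 := by
  have hii (i : ZMod d) : i = 2 * u.2 - i ↔ i = u.2 := by
    constructor
    · intro H
      exact (isUnit_two_zmod hodd).mul_left_cancel (by linear_combination H)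
    · intro H
      linear_combination 2 * H
  simp [Matrix.trace, Apt_apply hodd, hii]

lemma norm_trace_Apt_mul_Apt_mul_Apt (hodd : Odd d) (u v w : ZMod d × ZMod d) :
    ‖(Apt d u * Apt d v * Apt d w).trace‖ = 1 := by
  have hii (i : ZMod d) :
      i = 2 * w.2 - (2 * v.2 - (2 * u.2 - i)) ↔ i = u.2 - v.2 + w.2 := by
    constructor
    · intro H
      exact (isUnit_two_zmod hodd).mul_left_cancel (by linear_combination H)
    · intro H
      linear_combination 2 * H
  have hmid (i k : ZMod d) : (Apt d u * Apt d v) i k = if k = 2 * v.2 - (2 * u.2 - i) then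
      ZMod.stdAddChar (u.1 * (i - (2 * u.2 - i))) *
        ZMod.stdAddChar (v.1 * (2 * u.2 - i - k)) else 0 := by
    simp only [Matrix.mul_apply, Apt_apply hodd, ite_mul, zero_mul, Finset.sum_ite_eq',
      Finset.mem_univ, if_true]
    simp only [mul_ite, mul_zero]
  simp only [Matrix.trace, Matrix.diag_apply, Matrix.mul_apply (N := Apt d w), hmid,
    Apt_apply hodd w, ite_mul, zero_mul, Finset.sum_ite_eq', Finset.mem_univ, if_true, hii]
  simp

end CharacterForm

section TensorTrace

variable {d : ℕ} [NeZero d]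

lemma sum_idx (f : ZMod d → ZMod d → ZMod d → ℂ) :
    ∑ i : Idx d, f (i 0) (i 1) (i 2) = ∑ x, ∑ y, ∑ z, f x y z := by
  rw [← (Fin.consEquiv fun _ : Fin 3 => ZMod d).sum_comp, Fintype.sum_prod_type]
  refine Finset.sum_congr rfl fun x _ => ?_
  rw [← (finTwoArrowEquiv (ZMod d)).symm.sum_comp, Fintype.sum_prod_type]
  rfl

lemma trace_kron3 (A B C : Matrix (ZMod d) (ZMod d) ℂ) :
    (kron3 d A B C).trace = A.trace * B.trace * C.trace := by
  simp only [Matrix.trace, Matrix.diag_apply, kron3, Matrix.of_apply]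
  rw [sum_idx fun x y z => A x x * B y y * C z z, Finset.sum_mul_sum, Finset.sum_mul]
  simp only [Finset.sum_mul_sum]

lemma trace_kron3_mul_Perm3 (A B C : Matrix (ZMod d) (ZMod d) ℂ) (c : Equiv.Perm (Fin 3)) :
    (kron3 d A B C * Perm3 d c).trace =
      ∑ i : Idx d, A (i 0) (i (c⁻¹ 0)) * B (i 1) (i (c⁻¹ 1)) * C (i 2) (i (c⁻¹ 2)) := by
  refine Finset.sum_congr rfl fun i _ => ?_
  have hfun (j : Idx d) : (∀ k, j k = i (c⁻¹ k)) ↔ j = fun k => i (c⁻¹ k) := funext_iff.symm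
  simp only [Matrix.diag_apply, Matrix.mul_apply, kron3, Perm3, Matrix.of_apply, hfun, mul_ite,
    mul_one, mul_zero, Finset.sum_ite_eq', Finset.mem_univ, if_true]

lemma trace_mul_mul_eq_sum (A B C : Matrix (ZMod d) (ZMod d) ℂ) :
    (A * B * C).trace = ∑ x, ∑ y, ∑ z, A x y * B y z * C z x := by
  simp only [Matrix.trace, Matrix.diag_apply, Matrix.mul_apply, Finset.sum_mul]
  exact Finset.sum_congr rfl fun x _ => Finset.sum_comm

lemma trace_kron3_mul_Perm3_finRotate (A B C : Matrix (ZMod d) (ZMod d) ℂ) :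
    (kron3 d A B C * Perm3 d (finRotate 3)).trace = (A * C * B).trace := by
  rw [trace_kron3_mul_Perm3, trace_mul_mul_eq_sum]
  have h0 : (finRotate 3)⁻¹ 0 = 2 := by decide
  have h1 : (finRotate 3)⁻¹ 1 = 0 := by decide
  have h2 : (finRotate 3)⁻¹ 2 = 1 := by decide
  rw [h0, h1, h2, sum_idx fun x y z => A x z * B y x * C z y]
  refine Finset.sum_congr rfl fun x _ => Finset.sum_comm.trans ?_
  exact Finset.sum_congr rfl fun y _ => Finset.sum_congr rfl fun z _ => by ring

lemma trace_kron3_mul_Perm3_finRotate_inv (A B C : Matrix (ZMod d) (ZMod d) ℂ) :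
    (kron3 d A B C * Perm3 d (finRotate 3)⁻¹).trace = (A * B * C).trace := by
  rw [trace_kron3_mul_Perm3, trace_mul_mul_eq_sum, inv_inv]
  exact sum_idx fun x y z => A x y * B y z * C z x

end TensorTrace

/-- The phase-space coefficients of C = 2α·I − α·(P((123)) + P((132))) satisfy
Tr[(A^r ⊗ A^w ⊗ A^v)·C] = 2α·(1 − Re(Tr[A^w A^v A^r])) ≤ 0. -/
theorem phase_space_coefficients_of_C_nonpos
    (d : ℕ) [NeZero d] (hd : 3 ≤ d) (hodd : Odd d)
    (δ : ℝ) (hδ : δ ∈ Set.Icc (0 : ℝ) 1) (α : ℝ)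
    (hα : α = (1 - δ) * δ * ((d : ℝ) * (δ - 1) - δ) / ((d : ℝ) ^ 3 * ((d : ℝ) + 1)))
    (r w v : ZMod d × ZMod d) :
    (kron3 d (Apt d r) (Apt d w) (Apt d v) *
        ((2 * α) • (1 : Matrix (Idx d) (Idx d) ℂ)
          - α • (Perm3 d (finRotate 3) + Perm3 d (finRotate 3)⁻¹))).trace =
      ((2 * α * (1 - ((Apt d w * Apt d v * Apt d r).trace).re) : ℝ) : ℂ) ∧
    (2 * α * (1 - ((Apt d w * Apt d v * Apt d r).trace).re) : ℝ) ≤ 0 := by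
  have hreal : (Apt d r * Apt d v * Apt d w).trace + (Apt d r * Apt d w * Apt d v).trace =
      ((2 * ((Apt d w * Apt d v * Apt d r).trace).re : ℝ) : ℂ) := by
    have hcycle : (Apt d r * Apt d w * Apt d v).trace = (Apt d w * Apt d v * Apt d r).trace := by
      rw [Matrix.mul_assoc, Matrix.trace_mul_comm]
    have hconj : (Apt d r * Apt d v * Apt d w).trace =
        star (Apt d w * Apt d v * Apt d r).trace := by
      rw [← Matrix.trace_conjTranspose, Matrix.conjTranspose_mul, Matrix.conjTranspose_mul,
        Apt_isHermitian hodd, Apt_isHermitian hodd, Apt_isHermitian hodd, Matrix.mul_assoc]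
    rw [hcycle, hconj, add_comm, ← starRingEnd_apply, Complex.add_conj]
  refine ⟨?_, ?_⟩
  · rw [Matrix.mul_sub, Matrix.mul_smul, Matrix.mul_smul, Matrix.mul_add, Matrix.mul_one,
      Matrix.trace_sub, Matrix.trace_smul, Matrix.trace_smul, Matrix.trace_add,
      trace_kron3_mul_Perm3_finRotate, trace_kron3_mul_Perm3_finRotate_inv, trace_kron3,
      Apt_trace hodd, Apt_trace hodd, Apt_trace hodd, hreal, Complex.real_smul, Complex.real_smul]
    push_cast
    ring
  · have hre : ((Apt d w * Apt d v * Apt d r).trace).re ≤ 1 :=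
      (Complex.re_le_norm _).trans (norm_trace_Apt_mul_Apt_mul_Apt hodd w v r).le
    have hα0 : α ≤ 0 := by
      obtain ⟨h0, h1⟩ := hδ
      rw [hα]
      refine div_nonpos_of_nonpos_of_nonneg (mul_nonpos_of_nonneg_of_nonpos ?_ ?_) (by positivity)
      · exact mul_nonneg (sub_nonneg.2 h1) h0
      · have := mul_nonpos_of_nonneg_of_nonpos (Nat.cast_nonneg (α := ℝ) d) (sub_nonpos.2 h1)
        linarith
    exact mul_nonpos_of_nonpos_of_nonneg (by linarith) (by linarith)
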